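/- Let α_1,…,α_m ∈ (0,1) with Σ_{i=1}^m α_i = 1 but (α_1,…,α_m) ≠ (1/m,…,1/m). If f : [0,1]^m → ℂ is integrable and symmetric (invariant under all permutations of its coordinates) and satisfies ∫_{A_1 × ⋯ × A_m} f = 0 for every partition of [0,1] into measurable sets A_1,…,A_m with λ(A_i) = α_i, then f = 0 almost everywhere. -/

import Mathlib

open MeasureTheory

/-- The unit cube `[0,1]^m` as a subset of `Fin m → ℝ`. -/
def unitCube (m : ℕ) : Set (Fin m → ℝ) := Set.univ.pi fun _ => Set.Icc (0 : ℝ) 1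


lemma va_poly {m : ℕ} {V : Type*} [AddCommGroup V] [Module ℝ V]
    (Φ : MultilinearMap ℝ (fun _ : Fin m => V) ℂ) (a g : Fin m → V)
    (T : ℝ) (hT : 0 < T) (h : ∀ t : ℝ, 0 < t → t < T → Φ (fun i => a i + t • g i) = 0) :
    Φ (fun i => a i + g i) = 0 := by
  classical
  have key : ∀ t : ℝ, Φ (fun i => a i + t • g i) =
      ∑ s : Finset (Fin m), (t:ℂ) ^ (sᶜ).card * Φ (s.piecewise a g) := by
    intro t
    have h1 := Φ.map_add_univ a (fun i => t • g i)
    have h2 : (a + fun i => t • g i) = fun i => a i + t • g i := rfl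
    rw [h2] at h1
    rw [h1]
    refine Finset.sum_congr rfl fun s _ => ?_
    have h3 : s.piecewise a (fun i => t • g i) =
        (sᶜ).piecewise (fun i => t • (s.piecewise a g) i) (s.piecewise a g) := by
      funext i
      by_cases hi : i ∈ s <;> simp [Finset.piecewise, hi]
    rw [h3]
    have h4 := Φ.map_piecewise_smul (fun _ => t) (s.piecewise a g) sᶜ
    rw [h4]
    simp
  let P : Polynomial ℂ := ∑ s : Finset (Fin m), Polynomial.X ^ (sᶜ).card * Polynomial.C (Φ (s.piecewise a g))
  have hP : ∀ t : ℝ, P.eval (t:ℂ) = Φ (fun i => a i + t • g i) := by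
    intro t
    rw [key]
    simp only [P, Polynomial.eval_finsetSum, Polynomial.eval_mul, Polynomial.eval_pow, Polynomial.eval_X, Polynomial.eval_C]
  have hP0 : P = 0 := by
    apply Polynomial.eq_zero_of_infinite_isRoot
    have : ((fun t : ℝ => (t:ℂ)) '' Set.Ioo 0 T).Infinite :=
      (Set.Ioo_infinite hT).image (Complex.ofReal_injective.injOn)
    refine this.mono ?_
    rintro _ ⟨t, ht, rfl⟩
    show P.eval _ = 0
    rw [hP, h t ht.1 ht.2]
  have := hP 1
  rw [hP0] at this
  simpa using this.symm

lemma va_bilin {V : Type*} [AddCommGroup V] [Module ℝ V] (I : V →ₗ[ℝ] ℝ)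
    (B : V → V → ℂ) (hadd1 : ∀ u u' v, B (u + u') v = B u v + B u' v)
    (hadd2 : ∀ u v v', B u (v + v') = B u v + B u v')
    (hs1 : ∀ (c : ℝ) u v, B (c • u) v = c * B u v)
    (hs2 : ∀ (c : ℝ) u v, B u (c • v) = c * B u v)
    (hsym : ∀ u v, B u v = B v u)
    (r : V) (a b : ℝ) (ha : 0 < a) (hb : 0 < b) (hab : a ≠ b) (hr : I r = a + b)
    (H : ∀ u v, u + v = r → I u = a → I v = b → B u v = 0) (u v : V) : B u v = 0 := by
  have hρ : a + b ≠ 0 := by positivity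
  have exp : ∀ g, I g = 0 → ∀ t : ℝ, (a/(a+b) : ℝ) * ((b/(a+b) : ℝ) * B r r) - t * (a/(a+b) : ℝ) * B r g
      + t * (b/(a+b) : ℝ) * B r g - t * t * B g g = 0 := by
    intro g hg t
    have := H ((a/(a+b)) • r + t • g) ((b/(a+b)) • r + (-t) • g) (by
        have e : (a/(a+b)) • r + t • g + ((b/(a+b)) • r + (-t) • g) = (a/(a+b) + b/(a+b)) • r := by
          module
        rw [e, ← add_div, div_self hρ, one_smul])
      (by simp [hr, hg]; field_simp) (by simp [hr, hg]; field_simp)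
    simp only [hadd1, hadd2, hs1, hs2, hsym g r] at this
    rw [← this]
    push_cast
    ring
  have hac : (a:ℂ) ≠ 0 := by exact_mod_cast ha.ne'
  have hbc : (b:ℂ) ≠ 0 := by exact_mod_cast hb.ne'
  have hρc : (a:ℂ) + b ≠ 0 := by exact_mod_cast hρ
  have habc : (b:ℂ) - a ≠ 0 := by
    rw [sub_ne_zero]; exact_mod_cast hab.symm
  have hrr : B r r = 0 := by
    have := exp 0 (by simp) 0
    simpa [hac, hbc, hρc] using this
  have hrg : ∀ g, I g = 0 → B r g = 0 ∧ B g g = 0 := by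
    intro g hg
    have h1 := exp g hg 1
    have h2 := exp g hg (-1)
    rw [hrr] at h1 h2
    push_cast at h1 h2
    have e1 : ((b - a) / (a+b) : ℂ) * B r g = 0 := by linear_combination (h1 - h2)/2
    have e2 : B g g = 0 := by linear_combination -(h1 + h2)/2
    refine ⟨?_, e2⟩
    simpa [habc, hρc] using e1
  have hvv : ∀ v, B v v = 0 := by
    intro v
    have hg : I (v - (I v / (a+b)) • r) = 0 := by simp [hr]; field_simp; simp
    obtain ⟨h1, h2⟩ := hrg _ hg
    have e : v = (I v / (a+b)) • r + (v - (I v / (a+b)) • r) := by abel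
    rw [e]
    generalize v - (I v / (a+b)) • r = g at *
    simp only [hadd1, hadd2, hs1, hs2, hsym g r, h1, h2, hrr]
    simp
  have := hvv (u + v)
  simp only [hadd1, hadd2, hvv, hsym v u] at this
  linear_combination this/2

lemma va_abstract {m : ℕ} {V : Type*} [AddCommGroup V] [Module ℝ V] (I : V →ₗ[ℝ] ℝ) (e : V)
    (he : I e = 1)
    (Φ : MultilinearMap ℝ (fun _ : Fin m => V) ℂ) (α : Fin m → ℝ) (hα : ∀ i, 0 < α i)
    (hsum : ∑ i, α i = 1) (p q : Fin m) (hpq : α p ≠ α q)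
    (hsym : ∀ h, Φ (h ∘ Equiv.swap p q) = Φ h)
    (H : ∀ h : Fin m → V, ∑ i, h i = e → (∀ i, I (h i) = α i) → Φ h = 0) (h : Fin m → V) :
    Φ h = 0 := by
  classical
  have hne : p ≠ q := fun h => hpq (by rw [h])
  have step1 : ∀ h : Fin m → V, (∀ i, i ∈ ({p, q} : Finset (Fin m))ᶜ → I (h i) = α i) → Φ h = 0 := by
    intro h hh
    have hup : ∀ u v, Function.update (Function.update h p u) q v
        = Function.update (Function.update h q v) p u := fun u v => Function.update_comm hne _ _ _
    have := va_bilin I (fun u v => Φ (Function.update (Function.update h p u) q v))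
      (fun u u' v => by simp only [hup]; exact Φ.map_update_add _ _ _ _)
      (fun u v v' => Φ.map_update_add _ _ _ _)
      (fun c u v => by simp only [hup]; rw [Φ.map_update_smul]; simp)
      (fun c u v => by rw [Φ.map_update_smul]; simp)
      (fun u v => by
        rw [← hsym]
        congr 1
        funext i
        simp only [Function.comp]
        by_cases h1 : i = p
        · subst h1; simp [hne]
        by_cases h2 : i = q
        · subst h2; simp [hne]
        rw [Equiv.swap_apply_of_ne_of_ne h1 h2]; simp [h1, h2])
      (e - ∑ i ∈ ({p, q} : Finset (Fin m))ᶜ, h i) (α p) (α q) (hα p) (hα q) hpq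
      (by
        rw [map_sub, map_sum, he, Finset.sum_congr rfl hh, ← hsum,
          ← Finset.sum_add_sum_compl ({p, q} : Finset (Fin m)), Finset.sum_pair hne]
        ring)
      (fun u v huv hu hv => by
        have hoff : ∀ i ∈ ({p, q} : Finset (Fin m))ᶜ,
            Function.update (Function.update h p u) q v i = h i := by
          intro i hi
          simp at hi
          simp [hi.1, hi.2]
        apply H
        · rw [← Finset.sum_add_sum_compl ({p, q} : Finset (Fin m)), Finset.sum_pair hne,
            Finset.sum_congr rfl hoff]
          simp [hne, huv]
        · intro i
          by_cases h2 : i = q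
          · subst h2; simp [hv]
          by_cases h1 : i = p
          · subst h1; simp [hne, hu]
          rw [hoff i (by simp [h1, h2])]
          exact hh i (by simp [h1, h2]))
      (h p) (h q)
    simpa using this
  have step2 : ∀ S : Finset (Fin m), (∀ h : Fin m → V, (∀ i ∈ S, I (h i) = α i) → Φ h = 0) →
      ∀ h, Φ h = 0 := by
    intro S
    induction S using Finset.induction_on with
    | empty => intro hS h; exact hS h (by simp)
    | insert j S hj ih =>
      intro hS
      apply ih
      intro h hh
      have hz : ∀ w, I w = α j → Φ (Function.update h j w) = 0 := by
        intro w hw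
        apply hS
        intro i hi
        by_cases hij : i = j
        · subst hij; simp [hw]
        · rw [Function.update_of_ne hij]
          exact hh i ((Finset.mem_insert.1 hi).resolve_left hij)
      have e1 : h j = (h j + (α j - I (h j)) • e) + (-((α j - I (h j))/ α j)) • (α j • e) := by
        have := (hα j).ne'
        rw [smul_smul, add_assoc, ← add_smul]
        have : (α j - I (h j)) + -((α j - I (h j)) / α j) * α j = 0 := by field_simp; ring
        rw [this]; simp
      rw [← Function.update_eq_self j h, e1, Φ.map_update_add, Φ.map_update_smul, hz _ (by simp [he]),
        hz _ (by simp [he])]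
      simp
  exact step2 _ step1 h

noncomputable def vaMu : Measure ℝ := volume.restrict (Set.Ico 0 1)
instance : IsProbabilityMeasure vaMu := ⟨by simp [vaMu]⟩
noncomputable def vaNu (m : ℕ) : Measure (Fin m → ℝ) := Measure.pi (fun _ => vaMu)
instance (m : ℕ) : IsProbabilityMeasure (vaNu m) := by unfold vaNu; infer_instance

def vaJ (M : ℕ) (l : Fin M) : Set ℝ := Set.Ico ((l:ℝ)/M) (((l:ℝ)+1)/M)

lemma vaJ_meas (M : ℕ) (l : Fin M) : MeasurableSet (vaJ M l) := measurableSet_Ico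

lemma vaJ_exists (M : ℕ) (hM : 0 < M) (x : ℝ) (hx : x ∈ Set.Ico (0:ℝ) 1) : ∃ l, x ∈ vaJ M l := by
  have hM' : (0:ℝ) < M := by exact_mod_cast hM
  have h0 : 0 ≤ x * M := mul_nonneg hx.1 hM'.le
  refine ⟨⟨⌊x * M⌋₊, ?_⟩, ?_, ?_⟩
  · rw [Nat.floor_lt h0]; nlinarith [hx.2]
  · rw [div_le_iff₀ hM']; exact Nat.floor_le h0
  · rw [lt_div_iff₀ hM']; exact Nat.lt_floor_add_one _

lemma vaJ_unique (M : ℕ) (x : ℝ) (l l' : Fin M) (h : x ∈ vaJ M l) (h' : x ∈ vaJ M l') : l = l' := by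
  have hM' : (0:ℝ) < M := by exact_mod_cast (Nat.zero_le _).trans_lt l.2
  obtain ⟨h1, h2⟩ := h
  obtain ⟨h3, h4⟩ := h'
  rw [div_le_iff₀ hM'] at h1 h3
  rw [lt_div_iff₀ hM'] at h2 h4
  have a : (l:ℝ) < l' + 1 := by linarith
  have b : (l':ℝ) < l + 1 := by linarith
  have a' : (l:ℕ) < l' + 1 := by exact_mod_cast a
  have b' : (l':ℕ) < l + 1 := by exact_mod_cast b
  exact Fin.ext (by omega)

lemma vaJ_subset (M : ℕ) (l : Fin M) : vaJ M l ⊆ Set.Ico 0 1 := by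
  have hM' : (0:ℝ) < M := by exact_mod_cast (Nat.zero_le _).trans_lt l.2
  rintro x ⟨h1, h2⟩
  refine ⟨le_trans (by positivity) h1, h2.trans_le ?_⟩
  rw [div_le_one hM']
  exact_mod_cast l.2

lemma va_ae (m : ℕ) : ∀ᵐ x ∂(vaNu m), ∀ i, x i ∈ Set.Ico (0:ℝ) 1 := by
  rw [ae_all_iff]
  intro i
  have h : ∀ᵐ y ∂vaMu, y ∈ Set.Ico (0:ℝ) 1 := ae_restrict_mem measurableSet_Ico
  exact (Measure.tendsto_eval_ae_ae (μ := fun _ : Fin m => vaMu) (i := i)).eventually h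

noncomputable def vaStep {m M : ℕ} (G : (Fin m → Fin M) → ℂ) (x : Fin m → ℝ) : ℂ :=
  ∑ j : Fin m → Fin M, G j * ∏ i, (((vaJ M (j i)).indicator 1 (x i) : ℝ) : ℂ)

lemma vaStep_eq {m M : ℕ} (G : (Fin m → Fin M) → ℂ) (x : Fin m → ℝ) (j : Fin m → Fin M)
    (hj : ∀ i, x i ∈ vaJ M (j i)) : vaStep G x = G j := by
  unfold vaStep
  rw [Finset.sum_eq_single j]
  · simp [Set.indicator_of_mem (hj _)]
  · intro j' _ hne
    obtain ⟨i, hi⟩ := Function.ne_iff.1 hne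
    rw [Finset.prod_eq_zero (Finset.mem_univ i), mul_zero]
    rw [Set.indicator_of_notMem (fun h => hi (vaJ_unique M _ _ _ h (hj i)))]; simp
  · simp

lemma va_prod_meas {m : ℕ} (w : Fin m → ℝ → ℝ) (hw : ∀ i, Measurable (w i)) :
    Measurable (fun x : Fin m → ℝ => ∏ i, ((w i (x i) : ℝ) : ℂ)) :=
  Finset.measurable_prod _ fun i _ =>
    Complex.measurable_ofReal.comp ((hw i).comp (measurable_pi_apply i))

lemma vaStep_meas {m M : ℕ} (G : (Fin m → Fin M) → ℂ) : Measurable (vaStep G) := by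
  unfold vaStep
  exact Finset.measurable_sum _ fun j _ => measurable_const.mul
    (va_prod_meas (fun i => (vaJ M (j i)).indicator 1)
      (fun i => measurable_one.indicator (vaJ_meas _ _)))

lemma va_prod_int {m : ℕ} (f : (Fin m → ℝ) → ℂ) (hf : Integrable f (vaNu m))
    (w : Fin m → ℝ → ℝ) (hw : ∀ i, Measurable (w i))
    (hb : ∀ i, ∃ C, ∀ x, |w i x| ≤ C) :
    Integrable (fun x => f x * ∏ i, ((w i (x i) : ℝ) : ℂ)) (vaNu m) := by
  choose C hC using hb
  refine hf.mul_bdd (c := ∏ i, C i) (va_prod_meas w hw).aestronglyMeasurable (ae_of_all _ fun x => ?_)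
  rw [norm_prod]
  exact Finset.prod_le_prod (fun _ _ => norm_nonneg _) fun i _ => by
    rw [Complex.norm_real]; exact hC i _

lemma va_approx {m : ℕ} (f : (Fin m → ℝ) → ℂ) (hf : Integrable f (vaNu m)) (ε : ℝ) (hε : 0 < ε) :
    ∃ M : ℕ, 0 < M ∧ ∃ G : (Fin m → Fin M) → ℂ, Integrable (vaStep G) (vaNu m) ∧
      ∫ x, ‖f x - vaStep G x‖ ∂(vaNu m) ≤ ε := by
  obtain ⟨g, hgs, hfg, hgc, hgi⟩ := hf.exists_hasCompactSupport_integral_sub_le (half_pos hε)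
  have huc := hgs.uniformContinuous_of_continuous hgc
  obtain ⟨δ, hδ, hd⟩ := Metric.uniformContinuous_iff.1 huc (ε/2) (half_pos hε)
  obtain ⟨n, hn⟩ := exists_nat_one_div_lt hδ
  have hbound : ∀ᵐ x ∂(vaNu m), ‖g x - vaStep (M := n+1) (fun j => g (fun i => ((j i : ℕ):ℝ)/((n+1:ℕ):ℝ))) x‖ ≤ ε/2 := by
    filter_upwards [va_ae m] with x hx
    choose j hj using fun i => vaJ_exists (n+1) (Nat.succ_pos n) (x i) (hx i)
    rw [vaStep_eq _ x j hj, ← dist_eq_norm]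
    apply le_of_lt
    apply hd
    refine lt_of_le_of_lt ?_ hn
    rw [dist_pi_le_iff (by positivity)]
    intro i
    obtain ⟨h1, h2⟩ := hj i
    rw [Real.dist_eq, abs_of_nonneg (by linarith)]
    rw [add_div] at h2
    push_cast at h1 h2 ⊢
    linarith
  have hmeas := (vaStep_meas (M := n+1) (fun j : Fin m → Fin (n+1) => g (fun i => ((j i : ℕ):ℝ)/((n+1:ℕ):ℝ))))
  have hgs_int : Integrable (fun x => g x - vaStep (M := n+1) (fun j => g (fun i => ((j i : ℕ):ℝ)/((n+1:ℕ):ℝ))) x) (vaNu m) :=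
    Integrable.of_bound (hgi.1.sub hmeas.aestronglyMeasurable) (ε/2) hbound
  refine ⟨n+1, Nat.succ_pos n, fun j => g (fun i => ((j i : ℕ):ℝ)/((n+1:ℕ):ℝ)), ?_, ?_⟩
  · have := hgi.sub hgs_int
    refine this.congr (ae_of_all _ fun x => ?_)
    simp
  · have h2 : ∫ x, ‖g x - vaStep (M := n+1) (fun j => g (fun i => ((j i : ℕ):ℝ)/((n+1:ℕ):ℝ))) x‖ ∂(vaNu m) ≤ ε/2 := by
      calc _ ≤ ∫ x, ε/2 ∂(vaNu m) := integral_mono_ae hgs_int.norm (integrable_const _) hbound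
        _ = ε/2 := by simp
    calc _ ≤ ∫ x, (‖f x - g x‖ + ‖g x - vaStep (M := n+1) (fun j => g (fun i => ((j i : ℕ):ℝ)/((n+1:ℕ):ℝ))) x‖) ∂(vaNu m) := by
            refine integral_mono_of_nonneg (ae_of_all _ fun x => norm_nonneg _)
              ((hf.sub hgi).norm.add hgs_int.norm) (ae_of_all _ fun x => ?_)
            exact norm_sub_le_norm_sub_add_norm_sub _ _ _
      _ = _ := integral_add (hf.sub hgi).norm hgs_int.norm
      _ ≤ ε := by linarith

lemma va_weight {m M : ℕ} (f : (Fin m → ℝ) → ℂ) (hf : Integrable f (vaNu m)) (ε : ℝ)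
    (G : (Fin m → Fin M) → ℂ) (hG : Integrable (vaStep G) (vaNu m))
    (hfG : ∫ x, ‖f x - vaStep G x‖ ∂(vaNu m) ≤ ε)
    (w : Fin m → ℝ → ℝ) (hw : ∀ i, Measurable (w i)) (hb : ∀ i x, |w i x| ≤ 1) :
    ‖(∫ x, f x * ∏ i, ((w i (x i) : ℝ) : ℂ) ∂(vaNu m)) -
      ∑ j : Fin m → Fin M, G j * ∏ i, ((∫ x in vaJ M (j i), w i x ∂vaMu : ℝ) : ℂ)‖ ≤ ε := by
  have e : ∫ x, vaStep G x * ∏ i, ((w i (x i) : ℝ) : ℂ) ∂(vaNu m) =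
      ∑ j : Fin m → Fin M, G j * ∏ i, ((∫ x in vaJ M (j i), w i x ∂vaMu : ℝ) : ℂ) := by
    unfold vaStep
    simp only [Finset.sum_mul, mul_assoc, ← Finset.prod_mul_distrib]
    rw [integral_finsetSum]
    · refine Finset.sum_congr rfl fun j _ => ?_
      rw [integral_const_mul]
      congr 1
      rw [vaNu, integral_fintype_prod_eq_prod (f := fun i y =>
        (((vaJ M (j i)).indicator 1 y : ℝ) : ℂ) * ((w i y : ℝ) : ℂ))]
      refine Finset.prod_congr rfl fun i _ => ?_
      rw [← integral_indicator (vaJ_meas _ _), ← integral_complex_ofReal]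
      congr 1
      funext y
      by_cases hy : y ∈ vaJ M (j i) <;> simp [hy]
    · intro j _
      have := va_prod_int (fun _ => G j) (integrable_const _)
        (fun i y => (vaJ M (j i)).indicator 1 y * w i y)
        (fun i => (measurable_one.indicator (vaJ_meas _ _)).mul (hw i))
        (fun i => ⟨1, fun y => by by_cases hy : y ∈ vaJ M (j i) <;> simp [hy, hb]⟩)
      simpa using this
  rw [← e, ← integral_sub (va_prod_int f hf w hw fun i => ⟨1, hb i⟩)
    (va_prod_int _ hG w hw fun i => ⟨1, hb i⟩)]
  refine (norm_integral_le_integral_norm _).trans (le_trans ?_ hfG)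
  refine integral_mono_of_nonneg (ae_of_all _ fun x => norm_nonneg _)
              ((hf.sub hG).norm) (ae_of_all _ fun x => ?_)
  simp only []
  rw [← sub_mul, norm_mul, norm_prod]
  refine mul_le_of_le_one_right (norm_nonneg _) (Finset.prod_le_one (fun _ _ => norm_nonneg _) fun i _ => ?_)
  rw [Complex.norm_real]; exact hb i _

lemma va_split : ∀ (m : ℕ) (a : Fin m → ℝ) (_ : ∀ i, 0 ≤ a i) (b : ℝ), ∃ A : Fin m → Set ℝ,
    (∀ i, MeasurableSet (A i)) ∧ (∀ i j, i ≠ j → Disjoint (A i) (A j)) ∧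
    (⋃ i, A i) = Set.Ico b (b + ∑ i, a i) ∧ ∀ i, volume (A i) = ENNReal.ofReal (a i) := by
  intro m
  induction m with
  | zero => intro a _ b; exact ⟨fun _ => ∅, by simp, by simp, by simp, fun i => i.elim0⟩
  | succ m ih =>
    intro a ha b
    obtain ⟨A, h1, h2, h3, h4⟩ := ih (fun i => a i.succ) (fun i => ha _) (b + a 0)
    have hd : ∀ i, Disjoint (Set.Ico b (b + a 0)) (A i) := by
      intro i
      have hs : A i ⊆ Set.Ico (b + a 0) (b + a 0 + ∑ i : Fin m, a i.succ) := h3 ▸ Set.subset_iUnion A i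
      rw [Set.disjoint_left]
      intro x hx hx'
      exact absurd (hs hx').1 (not_le.2 hx.2)
    refine ⟨Fin.cons (Set.Ico b (b + a 0)) A, ?_, ?_, ?_, ?_⟩
    · intro i
      refine Fin.cases ?_ (fun i => ?_) i
      · simp
      · simpa using h1 i
    · intro i j
      refine Fin.cases ?_ (fun i => ?_) i <;> refine Fin.cases ?_ (fun j => ?_) j
      · simp
      · intro _; simpa using hd j
      · intro _; simpa using (hd i).symm
      · intro h; simpa using h2 i j (fun e => h (by rw [e]))
    · rw [Fin.sum_univ_succ, ← add_assoc]
      have : (⋃ i, (Fin.cons (Set.Ico b (b + a 0)) A : Fin (m+1) → Set ℝ) i) =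
          Set.Ico b (b + a 0) ∪ ⋃ i, A i := by
        ext x; simp
      rw [this, h3, Set.Ico_union_Ico_eq_Ico (by linarith [ha 0])]
      have := Finset.sum_nonneg (s := Finset.univ) (f := fun i : Fin m => a i.succ) (fun i _ => ha _)
      linarith
    · intro i
      refine Fin.cases ?_ (fun i => ?_) i
      · simp
      · simpa using h4 i

lemma va_nu_eq (m : ℕ) : volume.restrict (unitCube m) = vaNu m := by
  unfold unitCube vaNu vaMu
  rw [volume_pi, Measure.restrict_pi_pi]
  congr 1
  funext i
  exact (Measure.restrict_congr_set Ico_ae_eq_Icc).symm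

lemma va_box {m : ℕ} (f : (Fin m → ℝ) → ℂ) (A : Fin m → Set ℝ) (x : Fin m → ℝ) :
    f x * ∏ i, (((A i).indicator 1 (x i) : ℝ) : ℂ) = (Set.univ.pi A).indicator f x := by
  by_cases hx : x ∈ Set.univ.pi A
  · rw [Set.indicator_of_mem hx]
    have : ∀ i, x i ∈ A i := fun i => hx i trivial
    simp [this]
  · rw [Set.indicator_of_notMem hx]
    simp only [Set.mem_univ_pi, not_forall] at hx
    obtain ⟨i, hi⟩ := hx
    rw [Finset.prod_eq_zero (Finset.mem_univ i), mul_zero]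
    simp [hi]

lemma va_box_int {m : ℕ} (f : (Fin m → ℝ) → ℂ) (A : Fin m → Set ℝ) (hA : ∀ i, MeasurableSet (A i))
    (hsub : ∀ i, A i ⊆ Set.Icc 0 1) :
    ∫ x, f x * ∏ i, (((A i).indicator 1 (x i) : ℝ) : ℂ) ∂(vaNu m) = ∫ x in Set.univ.pi A, f x := by
  simp only [va_box]
  have hm : MeasurableSet (Set.univ.pi A) := MeasurableSet.univ_pi hA
  rw [integral_indicator hm, ← va_nu_eq, Measure.restrict_restrict hm]
  congr 2
  exact Set.inter_eq_left.2 (Set.pi_mono fun i _ => hsub i)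

lemma va_frac {m : ℕ} (p : Fin m) (α : Fin m → ℝ)
    (f : (Fin m → ℝ) → ℂ) (hf : Integrable f (vaNu m))
    (hvanish : ∀ A : Fin m → Set ℝ, (∀ i, MeasurableSet (A i)) →
      (∀ i j, i ≠ j → Disjoint (A i) (A j)) →
      (⋃ i, A i) = Set.Icc (0:ℝ) 1 →
      (∀ i, volume (A i) = ENNReal.ofReal (α i)) →
      ∫ x in Set.univ.pi A, f x = 0)
    (h : Fin m → ℝ → ℝ) (hm : ∀ i, Measurable (h i)) (h0 : ∀ i x, 0 ≤ h i x)
    (h1 : ∀ x, ∑ i, h i x = 1) (hI : ∀ i, ∫ x, h i x ∂vaMu = α i) :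
    ∫ x, f x * ∏ i, ((h i (x i) : ℝ) : ℂ) ∂(vaNu m) = 0 := by
  classical
  have hle : ∀ i x, h i x ≤ 1 := fun i x => by
    rw [← h1 x]; exact Finset.single_le_sum (f := fun i => h i x) (fun i _ => h0 i x) (Finset.mem_univ i)
  have hb : ∀ i x, |h i x| ≤ 1 := fun i x => by rw [abs_of_nonneg (h0 i x)]; exact hle i x
  have hint : ∀ i, Integrable (h i) vaMu := fun i =>
    Integrable.of_bound (hm i).aestronglyMeasurable 1 (ae_of_all _ (hb i))
  have key : ∀ ε : ℝ, 0 < ε → ‖∫ x, f x * ∏ i, ((h i (x i) : ℝ) : ℂ) ∂(vaNu m)‖ ≤ ε + ε := by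
    intro ε hε
    obtain ⟨M, hM, G, hG, hfG⟩ := va_approx f hf ε hε
    have hM' : (0:ℝ) < M := by exact_mod_cast hM
    have hJ : ∀ l : Fin M, vaMu (vaJ M l) = ENNReal.ofReal (1 / M) := by
      intro l
      rw [vaMu, Measure.restrict_apply (vaJ_meas _ _), Set.inter_eq_left.2 (vaJ_subset M l), vaJ,
        Real.volume_Ico]
      congr 1; ring
    have hsplit : ∀ l : Fin M, ∃ A : Fin m → Set ℝ,
      (∀ i, MeasurableSet (A i)) ∧ (∀ i j, i ≠ j → Disjoint (A i) (A j)) ∧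
      (⋃ i, A i) = vaJ M l ∧
        ∀ i, volume (A i) = ENNReal.ofReal (∫ x in vaJ M l, h i x ∂vaMu) := by
      intro l
      obtain ⟨A, a1, a2, a3, a4⟩ := va_split m (fun i => ∫ x in vaJ M l, h i x ∂vaMu)
        (fun i => integral_nonneg (h0 i)) ((l:ℝ)/M)
      refine ⟨A, a1, a2, ?_, a4⟩
      rw [a3, ← integral_finsetSum _ (fun i _ => (hint i).integrableOn)]
      simp only [h1]
      have : ∫ x in vaJ M l, (1:ℝ) ∂vaMu = 1 / M := by
        rw [setIntegral_const, measureReal_def, hJ, ENNReal.toReal_ofReal (by positivity)]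
        simp
      rw [this, vaJ]
      congr 1
      ring
    choose A a1 a2 a3 a4 using hsplit
    have asub : ∀ l i, A l i ⊆ vaJ M l := fun l i => a3 l ▸ Set.subset_iUnion (A l) i
    let E : Fin m → Set ℝ := fun i => if i = p then {1} else ∅
    let B : Fin m → Set ℝ := fun i => (⋃ l, A l i) ∪ E i
    have hEm : ∀ i, MeasurableSet (E i) := by
      intro i; by_cases hi : i = p <;> simp [E, hi]
    have hE0 : ∀ i, volume (E i) = 0 := by
      intro i; by_cases hi : i = p <;> simp [E, hi]
    have hE1 : ∀ i x, x ∈ E i → x = 1 ∧ i = p := by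
      intro i x; by_cases hi : i = p <;> simp [E, hi]
    have hBm : ∀ i, MeasurableSet (B i) := fun i =>
      (MeasurableSet.iUnion fun l => a1 l i).union (hEm i)
    have hBJ : ∀ i l, B i ∩ vaJ M l = A l i := by
      intro i l
      ext x
      constructor
      · rintro ⟨hx | hx, hxl⟩
        · obtain ⟨l', hl'⟩ := Set.mem_iUnion.1 hx
          have := vaJ_unique M x _ _ (asub l' i hl') hxl
          rwa [this] at hl'
        · exact absurd (vaJ_subset M l hxl).2 (by rw [(hE1 i x hx).1]; simp)
      · intro hx
        exact ⟨Or.inl (Set.mem_iUnion.2 ⟨l, hx⟩), asub l i hx⟩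
    have hBd : ∀ i j, i ≠ j → Disjoint (B i) (B j) := by
      intro i j hij
      rw [Set.disjoint_left]
      have not1 : ∀ i, (1:ℝ) ∉ ⋃ l, A l i := by
        intro i h
        obtain ⟨l, hl⟩ := Set.mem_iUnion.1 h
        exact absurd (vaJ_subset M l (asub l i hl)).2 (by simp)
      rintro x (hx | hx) (hy | hy)
      · obtain ⟨l, hl⟩ := Set.mem_iUnion.1 hx
        obtain ⟨l', hl'⟩ := Set.mem_iUnion.1 hy
        have := vaJ_unique M x _ _ (asub l i hl) (asub l' j hl')
        subst this
        exact Set.disjoint_left.1 (a2 l i j hij) hl hl'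
      · rw [(hE1 j x hy).1] at hx; exact not1 i hx
      · rw [(hE1 i x hx).1] at hy; exact not1 j hy
      · exact hij ((hE1 i x hx).2.trans (hE1 j x hy).2.symm)
    have hBsub : ∀ i, B i ⊆ Set.Icc 0 1 := by
      rintro i x (hx | hx)
      · obtain ⟨l, hl⟩ := Set.mem_iUnion.1 hx
        exact Set.Ico_subset_Icc_self (vaJ_subset M l (asub l i hl))
      · rw [(hE1 i x hx).1]; simp
    have hBu : (⋃ i, B i) = Set.Icc (0:ℝ) 1 := by
      apply Set.Subset.antisymm
      · exact Set.iUnion_subset hBsub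
      · intro x hx
        rcases hx.2.lt_or_eq with h | h
        · obtain ⟨l, hl⟩ := vaJ_exists M hM x ⟨hx.1, h⟩
          rw [← a3 l] at hl
          obtain ⟨i, hi⟩ := Set.mem_iUnion.1 hl
          exact Set.mem_iUnion.2 ⟨i, Or.inl (Set.mem_iUnion.2 ⟨l, hi⟩)⟩
        · exact Set.mem_iUnion.2 ⟨p, Or.inr (by simp [E, h])⟩
    have hJu : (⋃ l, vaJ M l) = Set.Ico 0 1 := by
      apply Set.Subset.antisymm
      · exact Set.iUnion_subset (vaJ_subset M)
      · intro x hx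
        exact Set.mem_iUnion.2 (vaJ_exists M hM x hx)
    have hJd : Pairwise (Function.onFun Disjoint (vaJ M)) := by
      intro l l' hl
      exact Set.disjoint_left.2 fun x hx hx' => hl (vaJ_unique M x _ _ hx hx')
    have hBv : ∀ i, volume (B i) = ENNReal.ofReal (α i) := by
      intro i
      have e1 : volume (B i) = volume (⋃ l, A l i) :=
        le_antisymm ((measure_union_le _ _).trans (by rw [hE0, add_zero]))
          (measure_mono Set.subset_union_left)
      rw [e1, measure_iUnion (fun l l' hl => (hJd hl).mono (asub l i) (asub l' i)) (fun l => a1 l i),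
        tsum_fintype]
      simp only [a4]
      rw [← ENNReal.ofReal_sum_of_nonneg (fun l _ => integral_nonneg (h0 i)), ← hI i]
      congr 1
      rw [← integral_iUnion_fintype (vaJ_meas M) hJd (fun l => (hint i).integrableOn), hJu]
      rw [vaMu, Measure.restrict_restrict measurableSet_Ico, Set.inter_self]
    have hz := hvanish B hBm hBd hBu hBv
    rw [← va_box_int f B hBm hBsub] at hz
    have w1 := va_weight f hf ε G hG hfG h hm hb
    have w2 := va_weight f hf ε G hG hfG (fun i => (B i).indicator 1)
      (fun i => measurable_one.indicator (hBm i))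
      (fun i x => by by_cases hx : x ∈ B i <;> simp [hx])
    have e : ∀ i l, ∫ x in vaJ M l, (B i).indicator 1 x ∂vaMu = ∫ x in vaJ M l, h i x ∂vaMu := by
      intro i l
      rw [integral_indicator_one (hBm i), measureReal_def, Measure.restrict_apply (hBm i), hBJ, vaMu,
        Measure.restrict_apply (a1 l i), Set.inter_eq_left.2 ((asub l i).trans (vaJ_subset M l)), a4,
        ENNReal.toReal_ofReal (integral_nonneg (h0 i)), vaMu]
    simp only [e] at w2
    rw [hz, zero_sub, norm_neg] at w2
    calc _ = ‖_ - _ + _‖ := by rw [sub_add_cancel]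
      _ ≤ _ := norm_add_le _ _
      _ ≤ ε + ε := add_le_add w1 w2
  have : ‖∫ x, f x * ∏ i, ((h i (x i) : ℝ) : ℂ) ∂(vaNu m)‖ ≤ 0 := by
    apply le_of_forall_pos_le_add
    intro ε hε
    have := key (ε/2) (half_pos hε)
    linarith
  exact norm_le_zero_iff.1 this

def vaV : Submodule ℝ (ℝ → ℝ) where
  carrier := {h | Measurable h ∧ ∃ C, ∀ x, |h x| ≤ C}
  add_mem' := by
    rintro a b ⟨ha, C, hC⟩ ⟨hb, D, hD⟩
    exact ⟨ha.add hb, C + D, fun x => (abs_add_le _ _).trans (add_le_add (hC x) (hD x))⟩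
  zero_mem' := ⟨measurable_const, 0, by simp⟩
  smul_mem' := by
    rintro c a ⟨ha, C, hC⟩
    exact ⟨ha.const_smul c, |c| * C, fun x => by
      simp only [Pi.smul_apply, smul_eq_mul, abs_mul]
      exact mul_le_mul_of_nonneg_left (hC x) (abs_nonneg _)⟩

lemma vaV_int (h : vaV) : Integrable (h : ℝ → ℝ) vaMu := by
  obtain ⟨h, hm, C, hC⟩ := h
  exact Integrable.of_bound hm.aestronglyMeasurable C (ae_of_all _ hC)

noncomputable def vaI : vaV →ₗ[ℝ] ℝ where
  toFun h := ∫ x, (h : ℝ → ℝ) x ∂vaMu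
  map_add' a b := integral_add (vaV_int a) (vaV_int b)
  map_smul' c a := integral_const_mul c _

noncomputable def vaEv (t : ℝ) : vaV →ₗ[ℝ] ℂ where
  toFun h := (((h : ℝ → ℝ) t : ℝ) : ℂ)
  map_add' a b := by simp
  map_smul' c a := by simp

noncomputable def vaPsi {m : ℕ} (x : Fin m → ℝ) : MultilinearMap ℝ (fun _ : Fin m => vaV) ℂ :=
  (MultilinearMap.mkPiAlgebra ℝ (Fin m) ℂ).compLinearMap (fun i => vaEv (x i))

lemma vaPsi_apply {m : ℕ} (x : Fin m → ℝ) (h : Fin m → vaV) :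
    vaPsi x h = ∏ i, (((h i : ℝ → ℝ) (x i) : ℝ) : ℂ) := by
  simp [vaPsi, vaEv]

lemma vaPsi_int {m : ℕ} (f : (Fin m → ℝ) → ℂ) (hf : Integrable f (vaNu m)) (h : Fin m → vaV) :
    Integrable (fun x => f x * vaPsi x h) (vaNu m) := by
  simp only [vaPsi_apply]
  exact va_prod_int f hf (fun i => h i) (fun i => (h i).2.1) (fun i => (h i).2.2)

noncomputable def vaPhi {m : ℕ} (f : (Fin m → ℝ) → ℂ) (hf : Integrable f (vaNu m)) :
    MultilinearMap ℝ (fun _ : Fin m => vaV) ℂ where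
  toFun h := ∫ x, f x * vaPsi x h ∂(vaNu m)
  map_update_add' h i u v := by
    rw [← integral_add (vaPsi_int f hf _) (vaPsi_int f hf _)]
    congr 1
    funext x
    rw [MultilinearMap.map_update_add, mul_add]
  map_update_smul' h i c u := by
    rw [← integral_smul]
    congr 1
    funext x
    rw [MultilinearMap.map_update_smul, mul_smul_comm]

theorem vanishing_averages_symmetric {m : ℕ} (α : Fin m → ℝ)
    (hα : ∀ i, α i ∈ Set.Ioo (0:ℝ) 1) (hsum : ∑ i, α i = 1)
    (hne : α ≠ fun _ => 1 / (m : ℝ))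
    (f : (Fin m → ℝ) → ℂ) (hf : IntegrableOn f (unitCube m))
    (hsym : ∀ σ : Equiv.Perm (Fin m), ∀ x : Fin m → ℝ, f (x ∘ σ) = f x)
    (hvanish : ∀ A : Fin m → Set ℝ, (∀ i, MeasurableSet (A i)) →
      (∀ i j, i ≠ j → Disjoint (A i) (A j)) →
      (⋃ i, A i) = Set.Icc (0:ℝ) 1 →
      (∀ i, volume (A i) = ENNReal.ofReal (α i)) →
      ∫ x in Set.univ.pi A, f x = 0) :
    ∀ᵐ x ∂(volume.restrict (unitCube m)), f x = 0 := by
  classical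
  rw [IntegrableOn, va_nu_eq] at hf
  rw [va_nu_eq]
  -- two distinct weights
  obtain ⟨p, q, hpq⟩ : ∃ p q, α p ≠ α q := by
    by_contra! hall
    apply hne
    funext i
    have h1 : ∑ j, α j = m * α i := by
      rw [Finset.sum_congr rfl (fun j _ => hall j i)]; simp
    have hm : (m:ℝ) ≠ 0 := by
      intro h0
      rw [h0, zero_mul, hsum] at h1
      exact one_ne_zero h1
    rw [hsum] at h1
    field_simp
    linarith
  let e : vaV := ⟨fun _ => 1, measurable_const, 1, by simp⟩
  have he : vaI e = 1 := by simp [vaI, e]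
  let Φ := vaPhi f hf
  have hΦ : ∀ h, Φ h = ∫ x, f x * ∏ i, (((h i : ℝ → ℝ) (x i) : ℝ) : ℂ) ∂(vaNu m) := by
    intro h
    show ∫ x, f x * vaPsi x h ∂(vaNu m) = _
    simp only [vaPsi_apply]
  have hΦsym : ∀ h, Φ (h ∘ Equiv.swap p q) = Φ h := by
    intro h
    rw [hΦ, hΦ]
    have mp := measurePreserving_arrowCongr' (fun _ : Fin m => vaMu) (fun _ : Fin m => vaMu)
      (Equiv.swap p q) (MeasurableEquiv.refl ℝ) (fun _ => MeasurePreserving.id _)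
    have := mp.integral_comp' (fun x => f x * ∏ i, (((h i : ℝ → ℝ) (x i) : ℝ) : ℂ))
    unfold vaNu
    rw [← this]
    congr 1
    funext x
    have hx : (MeasurableEquiv.arrowCongr' (Equiv.swap p q) (MeasurableEquiv.refl ℝ)) x
        = x ∘ Equiv.swap p q := by
      funext i
      simp [MeasurableEquiv.arrowCongr', Equiv.arrowCongr', Equiv.arrowCongr]
    rw [hx, hsym]
    congr 1
    rw [← Equiv.prod_comp (Equiv.swap p q)]
    simp
  have hzero : ∀ h : Fin m → vaV, Φ h = 0 := by
    refine va_abstract vaI e he Φ α (fun i => (hα i).1) hsum p q hpq hΦsym ?_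
    intro h hs hI
    have hexp : ∀ i x, (h i : ℝ → ℝ) x = α i + ((h i : ℝ → ℝ) x - α i) := by intros; ring
    choose C hC using fun i => (h i - α i • e).2.2
    -- a common bound
    let D : ℝ := ∑ i, (|C i| + 1)/ α i + 1
    have hterm : ∀ i, 0 ≤ (|C i| + 1)/ α i := fun i => div_nonneg (by positivity) (hα i).1.le
    have hD : 0 < D := add_pos_of_nonneg_of_pos (Finset.sum_nonneg fun i _ => hterm i) one_pos
    have := va_poly Φ (fun i => α i • e) (fun i => h i - α i • e) (1/D) (by positivity) (by
      intro t ht htD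
      rw [hΦ]
      refine va_frac p α f hf hvanish _ (fun i => (α i • e + t • (h i - α i • e)).2.1) ?_ ?_ ?_
      · intro i x
        have hb := hC i x
        have h2 : |C i| + 1 ≤ D * α i := by
          rw [← div_le_iff₀ (hα i).1]
          have := Finset.single_le_sum (f := fun i => (|C i| + 1)/ α i) (fun i _ => hterm i) (Finset.mem_univ i)
          simp only [D]
          linarith
        have h3 : t * D < 1 := by rwa [lt_div_iff₀ hD] at htD
        have h4 : t * (|C i| + 1) ≤ α i := by
          calc _ ≤ t * (D * α i) := mul_le_mul_of_nonneg_left h2 ht.le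
            _ = t * D * α i := by ring
            _ ≤ 1 * α i := mul_le_mul_of_nonneg_right h3.le (hα i).1.le
            _ = _ := one_mul _
        have h5 : -(|C i| + 1) ≤ ((h i - α i • e : vaV) : ℝ → ℝ) x := by
          have := (abs_le.1 hb).1
          have := le_abs_self (C i)
          linarith
        show 0 ≤ α i * 1 + t * ((h i - α i • e : vaV) : ℝ → ℝ) x
        have := mul_le_mul_of_nonneg_left h5 ht.le
        linarith
      · intro x
        have hsx : ∑ i, (h i : ℝ → ℝ) x = 1 := by
          have := congrArg (fun v : vaV => (v : ℝ → ℝ) x) hs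
          simpa [e] using this
        show ∑ i, (α i * 1 + t * ((h i : ℝ → ℝ) x - α i * 1)) = 1
        rw [Finset.sum_add_distrib, ← Finset.mul_sum, Finset.sum_sub_distrib, hsx]
        simp [hsum]
      · intro i
        show vaI (α i • e + t • (h i - α i • e)) = α i
        simp [he, hI])
    simpa using this
  -- conclude from boxes
  have hall : ∀ s : Set (Fin m → ℝ), MeasurableSet s → ∫ x in s, f x ∂(vaNu m) = 0 := by
    have hbox : ∀ A : Fin m → Set ℝ, (∀ i, MeasurableSet (A i)) →
        ∫ x in Set.univ.pi A, f x ∂(vaNu m) = 0 := by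
      intro A hA
      have := hzero (fun i => ⟨(A i).indicator 1, measurable_one.indicator (hA i), 1, fun x => by
        by_cases hx : x ∈ A i <;> simp [hx]⟩)
      rw [hΦ] at this
      simp only [va_box] at this
      rwa [integral_indicator (MeasurableSet.univ_pi hA)] at this
    have htot : ∫ x, f x ∂(vaNu m) = 0 := by
      have := hbox (fun _ => Set.univ) (fun _ => MeasurableSet.univ)
      simpa using this
    refine MeasurableSpace.induction_on_inter generateFrom_pi.symm isPiSystem_pi ?_ ?_ ?_ ?_
    · simp
    · rintro _ ⟨A, hA, rfl⟩
      exact hbox A (fun i => hA i trivial)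
    · intro t ht h
      rw [setIntegral_compl ht hf, htot, h, sub_zero]
    · intro g hd hg h
      rw [integral_iUnion hg hd hf.integrableOn]
      simp [h]
  exact hf.ae_eq_zero_of_forall_setIntegral_eq_zero (fun s hs _ => hall s hs)
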